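/- Let D ⊂ ℂⁿ be a bounded domain, let f, g : D → ℂⁿ be bounded holomorphic maps, and let U ⊂ ℂ be a nonempty open set such that for every t ∈ U the map f + t·g maps D into D with the closure of its image compact and contained in D. Then the map U → D, t ↦ τ(f + t·g), assigning to t the unique fixed point of f + t·g, is holomorphic on U. -/

import Mathlib

open Filter Topology Metric Set

theorem hm_dist_le {E F : Type*} [NormedAddCommGroup E] [NormedSpace ℂ E]
    [NormedAddCommGroup F] [NormedSpace ℂ F] {f : E → F} {c z : E} {R M : ℝ}
    (hd : DifferentiableOn ℂ f (ball c R)) (hM : ∀ x ∈ ball c R, ‖f x‖ ≤ M)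
    (hz : z ∈ ball c R) : ‖f z - f c‖ ≤ 2 * M / R * ‖z - c‖ := by
  have hR : 0 < R := nonempty_ball.mp ⟨z, hz⟩
  have := Complex.dist_le_div_mul_dist_of_mapsTo_ball (R₂ := 2 * M) hd (fun x hx => by
    rw [mem_closedBall, dist_eq_norm]
    have h1 := hM x hx
    have h2 := hM c (mem_ball_self hR)
    linarith [norm_sub_le (f x) (f c)]) hz
  simpa [dist_eq_norm] using this

theorem hm_fderiv_le {E F : Type*} [NormedAddCommGroup E] [NormedSpace ℂ E]
    [NormedAddCommGroup F] [NormedSpace ℂ F] {f : E → F} {c : E} {R M : ℝ} (hR : 0 < R)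
    (hd : DifferentiableOn ℂ f (ball c R)) (hM : ∀ x ∈ ball c R, ‖f x‖ ≤ M) :
    ‖fderiv ℂ f c‖ ≤ 2 * M / R := by
  refine Complex.norm_fderiv_le_div_of_mapsTo_ball (R₂ := 2 * M) hd (fun x hx => ?_) hR
  rw [mem_closedBall, dist_eq_norm]
  have h1 := hM x hx
  have h2 := hM c (mem_ball_self hR)
  linarith [norm_sub_le (f x) (f c)]

theorem hm_strict {E F : Type*} [NormedAddCommGroup E] [NormedSpace ℂ E]
    [NormedAddCommGroup F] [NormedSpace ℂ F] {f : E → F} {D : Set E} (hD : IsOpen D)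
    (hd : DifferentiableOn ℂ f D) {c : E} (hc : c ∈ D) :
    HasStrictFDerivAt f (fderiv ℂ f c) c := by
  have hcont : ContinuousAt f c := (hd.differentiableAt (hD.mem_nhds hc)).continuousAt
  have hev : ∀ᶠ x in 𝓝 c, x ∈ D ∧ ‖f x‖ ≤ ‖f c‖ + 1 := by
    have := hcont.norm.eventually (eventually_lt_nhds (lt_add_one ‖f c‖))
    filter_upwards [this, hD.mem_nhds hc] with x h1 h2 using ⟨h2, h1.le⟩
  obtain ⟨R, hR, hball⟩ := Metric.eventually_nhds_iff_ball.mp hev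
  set M := ‖f c‖ + 1
  have hdd : ∀ x ∈ ball c R, DifferentiableAt ℂ f x := fun x hx =>
    hd.differentiableAt (hD.mem_nhds (hball x hx).1)
  refine hasStrictFDerivAt_of_hasFDerivAt_of_continuousAt
    (f' := fun x => fderiv ℂ f x) ?_ ?_
  · filter_upwards [ball_mem_nhds c hR] with x hx using (hdd x hx).hasFDerivAt
  · have key : ∀ z ∈ ball c (R / 4), ‖fderiv ℂ f z - fderiv ℂ f c‖ ≤
        2 * (2 * M / (R / 2) * ‖z - c‖) / (R / 4) := by
      intro z hz
      rw [mem_ball, dist_eq_norm] at hz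
      have hsub : ∀ x ∈ ball c (R / 4), x + (z - c) ∈ ball c R := by
        intro x hx
        rw [mem_ball, dist_eq_norm] at *
        have : x + (z - c) - c = (x - c) + (z - c) := by abel
        rw [this]
        linarith [norm_add_le (x - c) (z - c)]
      have hsub' : ∀ x ∈ ball c (R / 4), x ∈ ball c R := fun x hx =>
        ball_subset_ball (by linarith) hx
      have hc4 : c ∈ ball c (R / 4) := mem_ball_self (by linarith)
      have hdu : ∀ x ∈ ball c (R / 4),
          HasFDerivAt (fun y => f (y + (z - c)) - f y)
            (fderiv ℂ f (x + (z - c)) - fderiv ℂ f x) x := by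
        intro x hx
        refine HasFDerivAt.sub ?_ (hdd x (hsub' x hx)).hasFDerivAt
        have h1 := HasFDerivAt.comp x (hdd _ (hsub x hx)).hasFDerivAt
          ((hasFDerivAt_id x).add_const (z - c))
        rw [ContinuousLinearMap.comp_id] at h1
        exact h1
      have := hm_fderiv_le (f := fun y => f (y + (z - c)) - f y) (c := c) (R := R / 4)
        (M := 2 * M / (R / 2) * ‖z - c‖) (by linarith)
        (fun x hx => (hdu x hx).differentiableAt.differentiableWithinAt) (fun x hx => by
          have hbx : ball x (R / 2) ⊆ ball c R := by
            apply ball_subset_ball'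
            rw [mem_ball] at hx
            linarith
          have := hm_dist_le (f := f) (c := x) (z := x + (z - c)) (R := R / 2) (M := M)
            (fun y hy => (hdd y (hbx hy)).differentiableWithinAt)
            (fun y hy => (hball y (hbx hy)).2)
            (by rw [mem_ball, dist_eq_norm]; simp; linarith)
          simpa using this)
      rw [(hdu c hc4).fderiv] at this
      simpa using this
    rw [ContinuousAt, tendsto_iff_norm_sub_tendsto_zero]
    refine squeeze_zero' (Eventually.of_forall fun _ => norm_nonneg _)
      (by filter_upwards [ball_mem_nhds c (show 0 < R / 4 by linarith)] with z hz using key z hz) ?_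
    have : ContinuousAt (fun z : E => 2 * (2 * M / (R / 2) * ‖z - c‖) / (R / 4)) c := by fun_prop
    simpa [ContinuousAt] using this

theorem hm_iter_diff {E : Type*} [NormedAddCommGroup E] [NormedSpace ℂ E] {D : Set E}
    {F : E → E} (hF : DifferentiableOn ℂ F D) (hm : MapsTo F D D) (k : ℕ) :
    DifferentiableOn ℂ F^[k] D := by
  induction k with
  | zero => exact differentiableOn_id
  | succ k ih => rw [Function.iterate_succ]; exact ih.comp hF hm

/-- some power of the derivative at a fixed point is a strict contraction -/
theorem hm_contr {E : Type*} [NormedAddCommGroup E] [NormedSpace ℂ E] {D : Set E}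
    (hD : IsOpen D) (hb : Bornology.IsBounded D) {F : E → E} (hF : DifferentiableOn ℂ F D)
    (hc : IsCompact (closure (F '' D))) (hs : closure (F '' D) ⊆ D) {p : E} (hp : p ∈ D)
    (hfix : F p = p) : ∃ m : ℕ, ‖fderiv ℂ F p ^ m‖ < 1 := by
  obtain ⟨ε, hε, hth⟩ := hc.exists_thickening_subset_open hD hs
  obtain ⟨M, hM0, hM⟩ := hb.exists_pos_norm_le
  obtain ⟨R, hR, hball⟩ := Metric.isOpen_iff.mp hD p hp
  have hin : ∀ z ∈ D, F z ∈ closure (F '' D) := fun z hz =>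
    subset_closure (mem_image_of_mem _ hz)
  set δ : ℝ := ε / (4 * M) with hδ
  have hδ0 : 0 < δ := by positivity
  set G : E → E := fun z => F z + (δ : ℂ) • (F z - p) with hG
  have hGm : MapsTo G D D := by
    intro z hz
    apply hth
    rw [mem_thickening_iff]
    refine ⟨F z, hin z hz, ?_⟩
    rw [dist_eq_norm]
    have h1 := hM _ (hs (hin z hz))
    have h2 := hM _ hp
    have h3 : ‖F z - p‖ ≤ 2 * M := by linarith [norm_sub_le (F z) p]
    have : G z - F z = (δ : ℂ) • (F z - p) := by simp [hG]
    rw [this, norm_smul, Complex.norm_real, Real.norm_of_nonneg hδ0.le]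
    calc δ * ‖F z - p‖ ≤ δ * (2 * M) := by gcongr
      _ = ε / 2 := by rw [hδ]; field_simp; norm_num
      _ < ε := by linarith
  have hFp := (hF.differentiableAt (hD.mem_nhds hp)).hasFDerivAt
  have hGp : HasFDerivAt G (((1 + δ : ℝ) : ℂ) • fderiv ℂ F p) p := by
    have := hFp.add ((hFp.sub_const p).const_smul (δ : ℂ))
    have he : ((1 + δ : ℝ) : ℂ) • fderiv ℂ F p = fderiv ℂ F p + (δ : ℂ) • fderiv ℂ F p := by
      push_cast
      rw [add_smul, one_smul]
    rw [he]
    exact this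
  have hGd : DifferentiableOn ℂ G D := hF.add ((hF.sub_const p).const_smul (δ : ℂ))
  have hGfix : G p = p := by simp [hG, hfix]
  have hbound : ∀ k : ℕ, (1 + δ) ^ k * ‖fderiv ℂ F p ^ k‖ ≤ 2 * M / R := by
    intro k
    have h := hm_fderiv_le (f := G^[k]) (M := M) hR ((hm_iter_diff hGd hGm k).mono hball)
      (fun x hx => hM _ (hGm.iterate k (hball hx)))
    rw [(hGp.iterate hGfix k).fderiv, smul_pow, norm_smul, norm_pow, Complex.norm_real,
      Real.norm_of_nonneg (by linarith)] at h
    exact h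
  obtain ⟨k, hk⟩ := pow_unbounded_of_one_lt (2 * M / R) (show 1 < 1 + δ by linarith)
  refine ⟨k, ?_⟩
  by_contra! hcon
  have h0 : 0 < (1 + δ) ^ k := by positivity
  nlinarith [hbound k]

theorem hm_unique {E : Type*} [NormedAddCommGroup E] [NormedSpace ℂ E] {D : Set E}
    (hD : IsOpen D) (hconn : IsConnected D) (hb : Bornology.IsBounded D)
    {F : E → E} (hF : DifferentiableOn ℂ F D)
    (hc : IsCompact (closure (F '' D))) (hs : closure (F '' D) ⊆ D) {p q : E} (hp : p ∈ D)
    (hfix : F p = p) (hq : q ∈ D) (hqfix : F q = q) : q = p := by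
  obtain ⟨m, hm⟩ := hm_contr hD hb hF hc hs hp hfix
  have hFm : MapsTo F D D := fun z hz => hs (subset_closure (mem_image_of_mem _ hz))
  obtain ⟨M, hM0, hM⟩ := hb.exists_pos_norm_le
  set G := F^[m] with hG
  have hGd : DifferentiableOn ℂ G D := hm_iter_diff hF hFm m
  have hGm : MapsTo G D D := hFm.iterate m
  have hGfix : G p = p := Function.iterate_fixed hfix m
  have hGq : G q = q := Function.iterate_fixed hqfix m
  have hGp : HasFDerivAt G (fderiv ℂ F p ^ m) p :=
    (hF.differentiableAt (hD.mem_nhds hp)).hasFDerivAt.iterate hfix m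
  -- local attraction
  obtain ⟨c, hc1, hc2⟩ := exists_between hm
  have hc0 : 0 ≤ c := (norm_nonneg _).trans hc1.le
  have hev : ∀ᶠ z in 𝓝 p, ‖G z - p‖ ≤ c * ‖z - p‖ := by
    have h := (hGp.isLittleO).def (show 0 < c - ‖fderiv ℂ F p ^ m‖ by linarith)
    filter_upwards [h] with z hz
    rw [hGfix] at hz
    have h2 := (fderiv ℂ F p ^ m).le_opNorm (z - p)
    have h3 := norm_add_le (G z - p - (fderiv ℂ F p ^ m) (z - p)) ((fderiv ℂ F p ^ m) (z - p))
    rw [sub_add_cancel] at h3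
    linarith
  obtain ⟨r, hr, hloc⟩ := Metric.eventually_nhds_iff_ball.mp hev
  have hattr : ∀ z ∈ ball p r, Tendsto (fun k => G^[k] z) atTop (𝓝 p) := by
    intro z hz
    have hk : ∀ k : ℕ, ‖G^[k] z - p‖ ≤ c ^ k * ‖z - p‖ := by
      intro k
      induction k with
      | zero => simp
      | succ k ih =>
        rw [Function.iterate_succ_apply']
        have hle : c ^ k * ‖z - p‖ ≤ ‖z - p‖ :=
          mul_le_of_le_one_left (norm_nonneg _) (pow_le_one₀ hc0 hc2.le)
        have hmem : G^[k] z ∈ ball p r := by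
          rw [mem_ball, dist_eq_norm] at *
          linarith
        calc _ ≤ c * ‖G^[k] z - p‖ := hloc _ hmem
          _ ≤ c * (c ^ k * ‖z - p‖) := by gcongr
          _ = _ := by ring
    rw [tendsto_iff_norm_sub_tendsto_zero]
    refine squeeze_zero (fun _ => norm_nonneg _) hk ?_
    simpa using (tendsto_pow_atTop_nhds_zero_of_lt_one hc0 hc2).mul_const ‖z - p‖
  set A : Set E := {z | Tendsto (fun k => G^[k] z) atTop (𝓝 p)} with hA
  have hopen : ∀ z ∈ D, z ∈ A → ∀ᶠ w in 𝓝 z, w ∈ A := by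
    intro z hz hzA
    obtain ⟨k, hk⟩ := (hzA.eventually (ball_mem_nhds p hr)).exists
    have hcont : ContinuousAt G^[k] z :=
      ((hm_iter_diff hGd hGm k).differentiableAt (hD.mem_nhds hz)).continuousAt
    filter_upwards [hcont.eventually (isOpen_ball.mem_nhds hk)] with w hw
    have := hattr _ hw
    simp only [← Function.iterate_add_apply] at this
    exact (tendsto_add_atTop_iff_nat (f := fun j => G^[j] w) k).mp this
  have hclosed : ∀ z ∈ D, z ∈ closure (D ∩ A) → z ∈ A := by
    intro z hz hzc
    obtain ⟨R, hR, hball⟩ := Metric.isOpen_iff.mp hD z hz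
    change Tendsto (fun k => G^[k] z) atTop (𝓝 p)
    rw [Metric.tendsto_atTop]
    intro ε hε
    have hL : 0 < 2 * M / R := by positivity
    obtain ⟨w, ⟨hwD, hwA⟩, hw⟩ := Metric.mem_closure_iff.mp hzc
      (min R (ε / 2 / (2 * M / R))) (lt_min hR (by positivity))
    obtain ⟨N, hN⟩ := Metric.tendsto_atTop.mp hwA (ε / 2) (by linarith)
    refine ⟨N, fun k hk => ?_⟩
    have h1 := hN k hk
    rw [dist_comm] at hw
    have hwR : w ∈ ball z R := lt_of_lt_of_le hw (min_le_left _ _)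
    have h2 := hm_dist_le (f := G^[k]) (M := M) ((hm_iter_diff hGd hGm k).mono hball)
      (fun x hx => hM _ (hGm.iterate k (hball hx))) hwR
    have h3 : 2 * M / R * ‖w - z‖ < ε / 2 := by
      rw [← dist_eq_norm, ← lt_div_iff₀' hL]
      exact lt_of_lt_of_le hw (min_le_right _ _)
    rw [← dist_eq_norm, dist_comm] at h2
    linarith [dist_triangle (G^[k] z) (G^[k] w) p]
  have hpA : p ∈ A := hattr p (mem_ball_self hr)
  have hqA : q ∈ A := by
    have hsubset : D ⊆ D ∩ A := by
      refine hconn.isPreconnected.subset_of_closure_inter_subset ?_ ⟨p, hp, hp, hpA⟩ ?_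
      · rw [isOpen_iff_mem_nhds]
        rintro z ⟨hz, hzA⟩
        filter_upwards [hD.mem_nhds hz, hopen z hz hzA] with w h1 h2 using ⟨h1, h2⟩
      · rintro z ⟨hzc, hz⟩
        exact ⟨hz, hclosed z hz hzc⟩
    exact (hsubset hq).2
  have hconst : Tendsto (fun k => G^[k] q) atTop (𝓝 q) := by
    simp only [Function.iterate_fixed hGq]
    exact tendsto_const_nhds
  exact tendsto_nhds_unique hconst hqA

theorem hm_isUnit {E : Type*} [NormedAddCommGroup E] [NormedSpace ℂ E] [CompleteSpace E]
    (A : E →L[ℂ] E) (m : ℕ) (h : ‖A ^ m‖ < 1) : IsUnit (A - 1) := by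
  have h1 : IsUnit (1 - A ^ m) := isUnit_one_sub_of_norm_lt_one h
  have hcm : (1 - A) * (∑ i ∈ Finset.range m, A ^ i) = 1 - A ^ m := mul_neg_geom_sum A m
  have hcm' : (∑ i ∈ Finset.range m, A ^ i) * (1 - A) = 1 - A ^ m := geom_sum_mul_neg A m
  have hcomm : Commute (1 - A) (∑ i ∈ Finset.range m, A ^ i) := hcm.trans hcm'.symm
  have : IsUnit (1 - A) := (hcomm.isUnit_mul_iff.mp (hcm ▸ h1)).1
  simpa using this.neg

/-- Corollary 2.4 (an instance): if `f, g : D → ℂⁿ` are bounded holomorphic maps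
on a bounded domain `D ⊆ ℂⁿ` and `U ⊆ ℂ` is a nonempty open set such that
`f + t·g` is a self-map of `D` with relatively compact image for every `t ∈ U`,
then `t ↦ τ(f + t·g)`, sending `t` to the unique fixed point of `f + t·g`, is
holomorphic on `U`. -/
theorem heins_map_holomorphic_on_line (n : ℕ) (D : Set (Fin n → ℂ))
    (hDopen : IsOpen D) (hDconn : IsConnected D) (hDbdd : Bornology.IsBounded D)
    (f g : (Fin n → ℂ) → (Fin n → ℂ))
    (hf : DifferentiableOn ℂ f D) (hg : DifferentiableOn ℂ g D)
    (hfbdd : Bornology.IsBounded (f '' D)) (hgbdd : Bornology.IsBounded (g '' D))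
    (U : Set ℂ) (hUopen : IsOpen U) (hUne : U.Nonempty)
    (hmaps : ∀ t ∈ U, Set.MapsTo (fun z => f z + t • g z) D D)
    (hcpt : ∀ t ∈ U, IsCompact (closure ((fun z => f z + t • g z) '' D)))
    (hsub : ∀ t ∈ U, closure ((fun z => f z + t • g z) '' D) ⊆ D)
    (τ : ℂ → (Fin n → ℂ))
    (hτmem : ∀ t ∈ U, τ t ∈ D)
    (hτfix : ∀ t ∈ U, f (τ t) + t • g (τ t) = τ t) :
    DifferentiableOn ℂ τ U := by
  intro t₀ ht₀
  set p := τ t₀ with hp_def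
  have hp : p ∈ D := hτmem t₀ ht₀
  have hFd : ∀ t : ℂ, DifferentiableOn ℂ (fun z => f z + t • g z) D := fun t =>
    hf.add (hg.const_smul t)
  have hfix : f p + t₀ • g p = p := hτfix t₀ ht₀
  obtain ⟨m, hm⟩ := hm_contr hDopen hDbdd (hFd t₀) (hcpt t₀ ht₀) (hsub t₀ ht₀) hp hfix
  have hfs := hm_strict hDopen hf hp
  have hgs := hm_strict hDopen hg hp
  have hfp : fderiv ℂ (fun z => f z + t₀ • g z) p = fderiv ℂ f p + t₀ • fderiv ℂ g p :=
    (hfs.hasFDerivAt.add (hgs.hasFDerivAt.const_smul t₀)).fderiv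
  rw [hfp] at hm
  have hunit := hm_isUnit _ m hm
  set Φ : ℂ × (Fin n → ℂ) → (Fin n → ℂ) := fun x => f x.2 + x.1 • g x.2 - x.2 with hΦ
  have hsnd : HasStrictFDerivAt (Prod.snd : ℂ × (Fin n → ℂ) → (Fin n → ℂ))
    (ContinuousLinearMap.snd ℂ ℂ (Fin n → ℂ)) (t₀, p) := hasStrictFDerivAt_snd
  have hfst : HasStrictFDerivAt (Prod.fst : ℂ × (Fin n → ℂ) → ℂ)
    (ContinuousLinearMap.fst ℂ ℂ (Fin n → ℂ)) (t₀, p) := hasStrictFDerivAt_fst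
  have hΦs := ((HasStrictFDerivAt.comp (t₀, p) hfs hsnd).add
    (hfst.smul (HasStrictFDerivAt.comp (t₀, p) hgs hsnd))).sub hsnd
  obtain ⟨L, hΦs', hL⟩ : ∃ L : ℂ × (Fin n → ℂ) →L[ℂ] (Fin n → ℂ),
      HasStrictFDerivAt Φ L (t₀, p) ∧ L ∘L ContinuousLinearMap.inr ℂ ℂ (Fin n → ℂ) =
        fderiv ℂ f p + t₀ • fderiv ℂ g p - 1 := by
    refine ⟨_, hΦs, ?_⟩
    apply ContinuousLinearMap.ext
    intro v
    simp
  have hinv : (L ∘L ContinuousLinearMap.inr ℂ ℂ (Fin n → ℂ)).IsInvertible := by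
    obtain ⟨u, hu⟩ := hunit
    refine ⟨ContinuousLinearEquiv.unitsEquiv ℂ (Fin n → ℂ) u, ?_⟩
    rw [hL, ← hu]
    rfl
  set σ := hΦs'.implicitFunctionOfProdDomain hinv with hσ
  have hσt : Tendsto σ (𝓝 t₀) (𝓝 p) := hΦs'.tendsto_implicitFunctionOfProdDomain hinv
  have hσe := hΦs'.eventually_apply_implicitFunctionOfProdDomain hinv
  have hσd : DifferentiableAt ℂ σ t₀ :=
    (hΦs'.hasStrictFDerivAt_implicitFunctionOfProdDomain hinv).hasFDerivAt.differentiableAt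
  have heq : τ =ᶠ[𝓝 t₀] σ := by
    filter_upwards [hσe, hσt.eventually (hDopen.mem_nhds hp), hUopen.mem_nhds ht₀]
      with t h1 h2 h3
    refine hm_unique hDopen hDconn hDbdd (hFd t) (hcpt t h3) (hsub t h3) h2 ?_
      (hτmem t h3) (hτfix t h3)
    have h4 : f (σ t) + t • g (σ t) - σ t = f p + t₀ • g p - p := h1
    rw [hfix, sub_self] at h4
    exact sub_eq_zero.mp h4
  exact (hσd.congr_of_eventuallyEq heq).differentiableWithinAt
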